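/- For every n ≥ 2, the formula QUPARITY_n has a Q-Res+S refutation of length at most 3n+2, i.e., the empty clause can be derived using at most 3n+2 applications of S, R, U. -/

import Mathlib

/-! Generic framework for QBFs in prenex CNF. -/

inductive Q
  | ex
  | all
deriving DecidableEq

abbrev Lit (V : Type) := V × Bool
abbrev Clause (V : Type) := Finset (Lit V)
abbrev Cnf (V : Type) := Finset (Clause V)
abbrev QPrefix (V : Type) := List (Q × V)

variable {V : Type} [DecidableEq V]

/-- Negation of a literal. -/
def negLit (l : Lit V) : Lit V := (l.1, !l.2)

/-- Evaluation of a literal under an assignment. -/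
def evalLit (τ : V → Bool) (l : Lit V) : Bool := if l.2 then τ l.1 else !(τ l.1)

/-- An assignment satisfies a clause if some literal evaluates to true. -/
def SatClause (τ : V → Bool) (C : Clause V) : Prop := ∃ l ∈ C, evalLit τ l = true

/-- An assignment satisfies a CNF if it satisfies all clauses. -/
def SatCnf (τ : V → Bool) (φ : Cnf V) : Prop := ∀ C ∈ φ, SatClause τ C

/-- Recursive semantics of a quantifier prefix over a matrix predicate. -/
def QTrue : QPrefix V → (V → Bool) → ((V → Bool) → Prop) → Prop
  | [], τ, M => M τ
  | (Q.ex, v) :: P, τ, M => ∃ b, QTrue P (Function.update τ v b) M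
  | (Q.all, v) :: P, τ, M => ∀ b, QTrue P (Function.update τ v b) M

/-- Truth of a prenex CNF QBF (closed; the default assignment is irrelevant). -/
def QBFTrue (P : QPrefix V) (φ : Cnf V) : Prop :=
  QTrue P (fun _ => false) (fun τ => SatCnf τ φ)

/-- Two variables are in the same quantifier block of a prefix. -/
def SameBlock (P : QPrefix V) (v w : V) : Prop :=
  ∃ i j : ℕ, (∃ q : Q, P[i]? = some (q, v)) ∧ (∃ q : Q, P[j]? = some (q, w)) ∧
    ∀ (k₁ k₂ : ℕ) (e₁ e₂ : Q × V), min i j ≤ k₁ → k₁ ≤ k₂ → k₂ ≤ max i j →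
      P[k₁]? = some e₁ → P[k₂]? = some e₂ → e₁.1 = e₂.1

/-- An admissible literal map for a prefix: a bijection on literals commuting with
negation and moving variables only within their quantifier block. -/
structure Admissible (P : QPrefix V) (σ : Lit V → Lit V) : Prop where
  bij : Function.Bijective σ
  neg : ∀ l, σ (negLit l) = negLit (σ l)
  block : ∀ v w b c, σ (v, b) = (w, c) → v ≠ w → SameBlock P v w

/-- Action of a literal map on a clause. -/
def mapClause (σ : Lit V → Lit V) (C : Clause V) : Clause V := C.image σ

/-- A (syntactic) symmetry of a QBF: an admissible map sending the clause set to itself. -/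
def IsSymmetry (P : QPrefix V) (φ : Cnf V) (σ : Lit V → Lit V) : Prop :=
  Admissible P σ ∧ φ.image (mapClause σ) = φ

def IsExist (P : QPrefix V) (v : V) : Prop := (Q.ex, v) ∈ P
def IsUniv (P : QPrefix V) (v : V) : Prop := (Q.all, v) ∈ P

/-- A clause is a tautology if it contains complementary literals. -/
def Tauto (C : Clause V) : Prop := ∃ l ∈ C, negLit l ∈ C

/-- Rule R of Q-Res: resolution over an existential variable, with
non-tautological resolvent. -/
def ResStep (P : QPrefix V) (E₁ E₂ E : Clause V) : Prop :=
  ∃ x, IsExist P x ∧ (x, true) ∈ E₁ ∧ (x, false) ∈ E₂ ∧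
    E = E₁.erase (x, true) ∪ E₂.erase (x, false) ∧ ¬ Tauto E

/-- Prefix order on variables: `v` occurs strictly before `w`. -/
def LtP (P : QPrefix V) (v w : V) : Prop :=
  ∃ i j : ℕ, i < j ∧ (∃ q : Q, P[i]? = some (q, v)) ∧ (∃ q : Q, P[j]? = some (q, w))

/-- Rule U of Q-Res: universal reduction. -/
def URed (P : QPrefix V) (F₁ F : Clause V) : Prop :=
  ∃ l, IsUniv P l.1 ∧ l ∈ F₁ ∧ negLit l ∉ F₁ ∧ F = F₁.erase l ∧
    ∀ k ∈ F₁.erase l, IsExist P k.1 → LtP P k.1 l.1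

/-- Derivability in Q-Res (rules A, R, U). -/
inductive Derives (P : QPrefix V) (φ : Cnf V) : Clause V → Prop
  | ax {C : Clause V} : C ∈ φ → Derives P φ C
  | res {E₁ E₂ E : Clause V} :
      Derives P φ E₁ → Derives P φ E₂ → ResStep P E₁ E₂ E → Derives P φ E
  | ured {F₁ F : Clause V} : Derives P φ F₁ → URed P F₁ F → Derives P φ F

/-- Derivability in Q-Res+S (rules A, R, U, S). -/
inductive DerivesS (P : QPrefix V) (φ : Cnf V) : Clause V → Prop
  | ax {C : Clause V} : C ∈ φ → DerivesS P φ C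
  | res {E₁ E₂ E : Clause V} :
      DerivesS P φ E₁ → DerivesS P φ E₂ → ResStep P E₁ E₂ E → DerivesS P φ E
  | ured {F₁ F : Clause V} : DerivesS P φ F₁ → URed P F₁ F → DerivesS P φ F
  | sym {C : Clause V} {σ : Lit V → Lit V} :
      DerivesS P φ C → IsSymmetry P φ σ → DerivesS P φ (mapClause σ C)

/-- A clause available at step `i` of a derivation sequence: an input clause
(axiom rule A, not counted as a step) or an earlier line. -/
def Avail (φ : Cnf V) (D : List (Clause V)) (i : ℕ) (C : Clause V) : Prop :=
  C ∈ φ ∨ ∃ j, ∃ _ : j < i, ∃ hj : j < D.length, D[j]'hj = C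

/-- Line `C` at position `i` is justified by rule R or U from available clauses. -/
def StepOK (P : QPrefix V) (φ : Cnf V) (D : List (Clause V)) (i : ℕ) (C : Clause V) : Prop :=
  (∃ E₁ E₂, Avail φ D i E₁ ∧ Avail φ D i E₂ ∧ ResStep P E₁ E₂ C) ∨
  (∃ F₁, Avail φ D i F₁ ∧ URed P F₁ C)

/-- Line justified by rule R, U or the symmetry rule S. -/
def StepOKS (P : QPrefix V) (φ : Cnf V) (D : List (Clause V)) (i : ℕ) (C : Clause V) : Prop :=
  StepOK P φ D i C ∨
  (∃ F₁ σ, Avail φ D i F₁ ∧ IsSymmetry P φ σ ∧ C = mapClause σ F₁)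

/-- A Q-Res refutation, as a sequence of R/U steps ending in the empty clause;
its length is the number of R and U applications. -/
def IsRefutation (P : QPrefix V) (φ : Cnf V) (D : List (Clause V)) : Prop :=
  (∀ i (hi : i < D.length), StepOK P φ D i (D[i]'hi)) ∧ D.getLast? = some (∅ : Clause V)

/-- A Q-Res+S refutation. -/
def IsRefutationS (P : QPrefix V) (φ : Cnf V) (D : List (Clause V)) : Prop :=
  (∀ i (hi : i < D.length), StepOKS P φ D i (D[i]'hi)) ∧ D.getLast? = some (∅ : Clause V)

/-- A derivation sequence using rules A, R, U: every line is an input clause or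
follows from earlier lines by R or U. -/
def IsDerivation (P : QPrefix V) (φ : Cnf V) (D : List (Clause V)) : Prop :=
  ∀ i (hi : i < D.length), (D[i]'hi) ∈ φ ∨
    (∃ j k, ∃ hj : j < i, ∃ hk : k < i,
      ResStep P (D[j]'(Nat.lt_trans hj hi)) (D[k]'(Nat.lt_trans hk hi)) (D[i]'hi)) ∨
    (∃ j, ∃ hj : j < i, URed P (D[j]'(Nat.lt_trans hj hi)) (D[i]'hi))

/-! The KBKF formula family (variables indexed 1..n). -/

inductive KV
  | x (i : ℕ)
  | y (i : ℕ)
  | a (i : ℕ)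
  | z (i : ℕ)
deriving DecidableEq

/-- Prefix ∃x₁y₁∀a₁ … ∃xₙyₙ∀aₙ ∃z₁…zₙ. -/
def kPrefix (n : ℕ) : QPrefix KV :=
  ((List.range n).flatMap
    (fun j => [(Q.ex, KV.x (j+1)), (Q.ex, KV.y (j+1)), (Q.all, KV.a (j+1))])) ++
  (List.range n).map (fun j => (Q.ex, KV.z (j+1)))

/-- The tail z̄₁ ∨ … ∨ z̄ₙ. -/
def kZneg (n : ℕ) : Clause KV := (Finset.range n).image (fun j => ((KV.z (j+1), false) : Lit KV))

/-- The clauses of KBKF_n. -/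
def kbkf (n : ℕ) : Cnf KV :=
  {({(KV.x 1, false), (KV.y 1, false)} : Clause KV)} ∪
  ((Finset.range (n-1)).image (fun j =>
    ({(KV.x (j+1), true), (KV.a (j+1), false), (KV.x (j+2), false), (KV.y (j+2), false)} : Clause KV))) ∪
  ((Finset.range (n-1)).image (fun j =>
    ({(KV.y (j+1), true), (KV.a (j+1), true), (KV.x (j+2), false), (KV.y (j+2), false)} : Clause KV))) ∪
  {({(KV.x n, true), (KV.a n, false)} : Clause KV) ∪ kZneg n,
   ({(KV.y n, true), (KV.a n, true)} : Clause KV) ∪ kZneg n} ∪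
  ((Finset.range n).image (fun j => ({(KV.a (j+1), true), (KV.z (j+1), true)} : Clause KV))) ∪
  ((Finset.range n).image (fun j => ({(KV.a (j+1), false), (KV.z (j+1), true)} : Clause KV)))

/-- The symmetry σᵢ = (xᵢ yᵢ)(x̄ᵢ ȳᵢ)(aᵢ āᵢ) of KBKF_n. -/
def kSigma (i : ℕ) : Lit KV → Lit KV
  | (KV.x j, b) => if j = i then (KV.y j, b) else (KV.x j, b)
  | (KV.y j, b) => if j = i then (KV.x j, b) else (KV.y j, b)
  | (KV.a j, b) => if j = i then (KV.a j, !b) else (KV.a j, b)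
  | (KV.z j, b) => (KV.z j, b)

/-- The symmetry breaker ψₙ = (x̄₁∨y₁) ∧ … ∧ (x̄ₙ∨yₙ) for KBKF_n. -/
def kPsi (n : ℕ) : Cnf KV :=
  (Finset.range n).image (fun j => ({(KV.x (j+1), false), (KV.y (j+1), true)} : Clause KV))

/-! The QUPARITY formula family. -/

inductive PV
  | x (i : ℕ)
  | a (i : ℕ)
  | y (i : ℕ)
deriving DecidableEq

/-- Prefix ∃x₁…xₙ ∀a₁a₂ ∃y₂…yₙ. -/
def pPrefix (n : ℕ) : QPrefix PV :=
  (List.range n).map (fun j => ((Q.ex, PV.x (j+1)) : Q × PV)) ++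
  [(Q.all, PV.a 1), (Q.all, PV.a 2)] ++
  (List.range (n-1)).map (fun k => ((Q.ex, PV.y (k+2)) : Q × PV))

/-- a₁ ∨ a₂ with sign `s` (s = true: unprimed clauses, s = false: primed clauses). -/
def pAA (s : Bool) : Clause PV := {(PV.a 1, s), (PV.a 2, s)}

/-- The clauses of QUPARITY_n. -/
def quparity (n : ℕ) : Cnf PV :=
  ((Finset.univ : Finset Bool).biUnion (fun s =>
    ({({(PV.x 1, false), (PV.x 2, false), (PV.y 2, false)} : Clause PV) ∪ pAA s,
      ({(PV.x 1, false), (PV.x 2, true), (PV.y 2, true)} : Clause PV) ∪ pAA s,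
      ({(PV.x 1, true), (PV.x 2, false), (PV.y 2, true)} : Clause PV) ∪ pAA s,
      ({(PV.x 1, true), (PV.x 2, true), (PV.y 2, false)} : Clause PV) ∪ pAA s} : Cnf PV) ∪
    ((Finset.range (n-2)).biUnion (fun k =>
      ({({(PV.y (k+2), false), (PV.x (k+3), false), (PV.y (k+3), false)} : Clause PV) ∪ pAA s,
        ({(PV.y (k+2), false), (PV.x (k+3), true), (PV.y (k+3), true)} : Clause PV) ∪ pAA s,
        ({(PV.y (k+2), true), (PV.x (k+3), false), (PV.y (k+3), true)} : Clause PV) ∪ pAA s,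
        ({(PV.y (k+2), true), (PV.x (k+3), true), (PV.y (k+3), false)} : Clause PV) ∪ pAA s} : Cnf PV))))) ∪
  {({(PV.a 1, true), (PV.a 2, true), (PV.y n, true)} : Clause PV),
   ({(PV.a 1, false), (PV.a 2, false), (PV.y n, false)} : Clause PV)}

/-- The symmetry σ₁ = (x₁ x₂)(x̄₁ x̄₂) of QUPARITY_n. -/
def pSigma1 : Lit PV → Lit PV
  | (PV.x 1, b) => (PV.x 2, b)
  | (PV.x 2, b) => (PV.x 1, b)
  | l => l

/-- The symmetry σᵢ = (xᵢ x̄ᵢ)(a₁ ā₁)(a₂ ā₂)(yᵢ ȳᵢ)⋯(yₙ ȳₙ) of QUPARITY_n, 2 ≤ i ≤ n. -/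
def pSigma (n i : ℕ) : Lit PV → Lit PV
  | (PV.x j, b) => if j = i then (PV.x j, !b) else (PV.x j, b)
  | (PV.a j, b) => if j = 1 ∨ j = 2 then (PV.a j, !b) else (PV.a j, b)
  | (PV.y j, b) => if i ≤ j ∧ j ≤ n then (PV.y j, !b) else (PV.y j, b)

/-- The symmetry breaker ψₙ = (x̄₁ ∨ x₂) ∧ x̄₂ ∧ … ∧ x̄ₙ for QUPARITY_n. -/
def pPsi (n : ℕ) : Cnf PV :=
  {({(PV.x 1, false), (PV.x 2, true)} : Clause PV)} ∪
  (Finset.range (n-1)).image (fun k => ({(PV.x (k+2), false)} : Clause PV))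

/-! The modified family KBKF'_n with blocking universal variables b_j. -/

inductive KV2
  | x (i : ℕ)
  | b (i : ℕ)
  | y (i : ℕ)
  | a (i : ℕ)
  | z (i : ℕ)
deriving DecidableEq

/-- Prefix ∃x₁∀b₁∃y₁∀a₁ … ∃xₙ∀bₙ∃yₙ∀aₙ ∃z₁…zₙ of KBKF'_n. -/
def k2Prefix (n : ℕ) : QPrefix KV2 :=
  ((List.range n).flatMap
    (fun j => [(Q.ex, KV2.x (j+1)), (Q.all, KV2.b (j+1)),
               (Q.ex, KV2.y (j+1)), (Q.all, KV2.a (j+1))])) ++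
  (List.range n).map (fun j => (Q.ex, KV2.z (j+1)))

/-- The map σᵢ = (xᵢ yᵢ)(x̄ᵢ ȳᵢ)(aᵢ āᵢ) on the literals of KBKF'_n. -/
def k2Sigma (i : ℕ) : Lit KV2 → Lit KV2
  | (KV2.x j, c) => if j = i then (KV2.y j, c) else (KV2.x j, c)
  | (KV2.y j, c) => if j = i then (KV2.x j, c) else (KV2.y j, c)
  | (KV2.a j, c) => if j = i then (KV2.a j, !c) else (KV2.a j, c)
  | (KV2.b j, c) => (KV2.b j, c)
  | (KV2.z j, c) => (KV2.z j, c)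

theorem mem_quparity (n : ℕ) (C : Clause PV) : C ∈ quparity n ↔
    (∃ s b c, C = ({(PV.x 1, b), (PV.x 2, c), (PV.y 2, b ^^ c)} : Clause PV) ∪ pAA s) ∨
    (∃ k, k < n - 2 ∧ ∃ s b c,
      C = ({(PV.y (k+2), b), (PV.x (k+3), c), (PV.y (k+3), b ^^ c)} : Clause PV) ∪ pAA s) ∨
    (∃ s, C = ({(PV.a 1, s), (PV.a 2, s), (PV.y n, s)} : Clause PV)) := by
  simp only [quparity, Finset.mem_union, Finset.mem_biUnion, Finset.mem_univ, true_and,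
    Finset.mem_insert, Finset.mem_singleton, Finset.mem_range, Bool.exists_bool,
    Bool.xor_false, Bool.xor_true, Bool.not_false, Bool.not_true]
  constructor
  · rintro (((h | ⟨k, hk, h⟩) | (h | ⟨k, hk, h⟩)) | h)
    · left; tauto
    · right; left; exact ⟨k, hk, by tauto⟩
    · left; tauto
    · right; left; exact ⟨k, hk, by tauto⟩
    · right; right; tauto
  · rintro (h | ⟨k, hk, h⟩ | h)
    · left
      rcases h with h | h
      · left; left; tauto
      · right; left; tauto
    · left
      rcases h with h | h
      · left; right; exact ⟨k, hk, by tauto⟩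
      · right; right; exact ⟨k, hk, by tauto⟩
    · right; tauto

theorem mem_pPrefix_x (n i : ℕ) (h1 : 1 ≤ i) (h2 : i ≤ n) : IsExist (pPrefix n) (PV.x i) := by
  simp only [IsExist, pPrefix, List.mem_append, List.mem_map, List.mem_range]
  exact Or.inl (Or.inl ⟨i - 1, by omega, by simp; omega⟩)

theorem mem_pPrefix_y (n i : ℕ) (h1 : 2 ≤ i) (h2 : i ≤ n) : IsExist (pPrefix n) (PV.y i) := by
  simp only [IsExist, pPrefix, List.mem_append, List.mem_map, List.mem_range]
  exact Or.inr ⟨i - 2, by omega, by simp; omega⟩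

theorem pPrefix_get_x (n i : ℕ) (h : i < n) : (pPrefix n)[i]? = some (Q.ex, PV.x (i+1)) := by
  simp [pPrefix, List.getElem?_append, h]

theorem pPrefix_get_a1 (n : ℕ) : (pPrefix n)[n]? = some (Q.all, PV.a 1) := by
  simp [pPrefix, List.getElem?_append]

theorem pPrefix_get_a2 (n : ℕ) : (pPrefix n)[n+1]? = some (Q.all, PV.a 2) := by
  simp [pPrefix, List.getElem?_append]

theorem mapClause_invol (σ : Lit PV → Lit PV) (h : ∀ l, σ (σ l) = l) (C : Clause PV) :
    mapClause σ (mapClause σ C) = C := by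
  ext l
  simp [mapClause, Finset.image_image, Function.comp_def, h]

theorem symm_of_invol (P : QPrefix PV) (φ : Cnf PV) (σ : Lit PV → Lit PV)
    (h : ∀ l, σ (σ l) = l) (hneg : ∀ l, σ (negLit l) = negLit (σ l))
    (hb : ∀ v w b c, σ (v, b) = (w, c) → v ≠ w → SameBlock P v w)
    (hm : ∀ C ∈ φ, mapClause σ C ∈ φ) : IsSymmetry P φ σ := by
  refine ⟨⟨Function.Involutive.bijective h, hneg, hb⟩, ?_⟩
  ext C
  rw [Finset.mem_image]
  constructor
  · rintro ⟨E, hE, rfl⟩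
    exact hm E hE
  · intro hC
    exact ⟨mapClause σ C, hm C hC, mapClause_invol σ h C⟩

theorem pSigma_symm (n i : ℕ) (h1 : 2 ≤ i) (h2 : i ≤ n) :
    IsSymmetry (pPrefix n) (quparity n) (pSigma n i) := by
  apply symm_of_invol
  · rintro ⟨v | v | v, b⟩ <;> simp only [pSigma] <;> split_ifs with h <;> simp [pSigma, h]
    
  · rintro ⟨v | v | v, b⟩ <;> simp only [pSigma, negLit] <;> split_ifs with h <;> simp
  · rintro (v | v | v) w b c h hne <;> simp only [pSigma] at h <;> split_ifs at h <;>
      simp_all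
  · intro C hC
    rw [mem_quparity] at hC ⊢
    rcases hC with ⟨s, b, c, rfl⟩ | ⟨k, hk, s, b, c, rfl⟩ | ⟨s, rfl⟩
    · left
      by_cases h : i = 2
      · subst h
        exact ⟨!s, b, !c, by simp [mapClause, pSigma, Finset.image_union, Finset.image_insert, pAA, h2]⟩
      · exact ⟨!s, b, c, by
          simp [mapClause, pSigma, Finset.image_union, Finset.image_insert, pAA,
            show ¬ 1 = i by omega, show ¬ 2 = i by omega, show ¬ i ≤ 2 by omega]⟩
    · right; left
      refine ⟨k, hk, !s, ?_⟩
      rcases lt_trichotomy i (k+3) with h | h | h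
      · exact ⟨!b, c, by
          simp [mapClause, pSigma, Finset.image_union, Finset.image_insert, pAA,
            show ¬ k + 3 = i by omega, show i ≤ k + 2 by omega, show i ≤ k + 3 by omega,
            show k + 2 ≤ n by omega, show k + 3 ≤ n by omega]⟩
      · exact ⟨b, !c, by
          simp [mapClause, pSigma, Finset.image_union, Finset.image_insert, pAA,
            show k + 3 = i by omega, show ¬ i ≤ k + 2 by omega, show i ≤ n by omega]⟩
      · exact ⟨b, c, by
          simp [mapClause, pSigma, Finset.image_union, Finset.image_insert, pAA,
            show ¬ k + 3 = i by omega, show ¬ i ≤ k + 2 by omega, show ¬ i ≤ k + 3 by omega]⟩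
    · right; right
      exact ⟨!s, by simp [mapClause, pSigma, Finset.image_insert, h2]⟩

theorem pSigma1_x (j : ℕ) (h1 : j ≠ 1) (h2 : j ≠ 2) (b : Bool) :
    pSigma1 (PV.x j, b) = (PV.x j, b) := by
  unfold pSigma1
  split <;> simp_all

theorem sameBlock_x (n i j : ℕ) (hi : i < n) (hj : j < n) :
    SameBlock (pPrefix n) (PV.x (i+1)) (PV.x (j+1)) := by
  refine ⟨i, j, ⟨_, pPrefix_get_x n i hi⟩, ⟨_, pPrefix_get_x n j hj⟩, ?_⟩
  intro k₁ k₂ e₁ e₂ h1 h2 h3 h4 h5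
  rw [pPrefix_get_x n k₁ (by omega)] at h4
  rw [pPrefix_get_x n k₂ (by omega)] at h5
  cases h4
  cases h5
  rfl

theorem pSigma1_symm (n : ℕ) (hn : 2 ≤ n) :
    IsSymmetry (pPrefix n) (quparity n) pSigma1 := by
  have key : ∀ v b, (v = PV.x 1 ∧ pSigma1 (v, b) = (PV.x 2, b)) ∨
      (v = PV.x 2 ∧ pSigma1 (v, b) = (PV.x 1, b)) ∨
      (v ≠ PV.x 1 ∧ v ≠ PV.x 2 ∧ pSigma1 (v, b) = (v, b)) := by
    intro v b
    by_cases h1 : v = PV.x 1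
    · subst h1; left; simp [pSigma1]
    by_cases h2 : v = PV.x 2
    · subst h2; right; left; simp [pSigma1]
    right; right
    refine ⟨h1, h2, ?_⟩
    unfold pSigma1
    split <;> simp_all
  apply symm_of_invol
  · rintro ⟨v, b⟩
    rcases key v b with ⟨rfl, h⟩ | ⟨rfl, h⟩ | ⟨_, _, h⟩
    · simp [pSigma1]
    · simp [pSigma1]
    · rw [h, h]
  · rintro ⟨v, b⟩
    rcases key v b with ⟨rfl, h⟩ | ⟨rfl, h⟩ | ⟨h1, h2, h⟩
    · simp [pSigma1, negLit]
    · simp [pSigma1, negLit]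
    · rw [h]
      rcases key v (!b) with ⟨rfl, h⟩ | ⟨rfl, h⟩ | ⟨_, _, h⟩
      · exact absurd rfl h1
      · exact absurd rfl h2
      · exact h
  · intro v w b c h hne
    rcases key v b with ⟨rfl, h'⟩ | ⟨rfl, h'⟩ | ⟨_, _, h'⟩
    · rw [h'] at h; cases h
      exact sameBlock_x n 0 1 (by omega) (by omega)
    · rw [h'] at h; cases h
      exact sameBlock_x n 1 0 (by omega) (by omega)
    · rw [h'] at h; cases h
      exact absurd rfl hne
  · intro C hC
    rw [mem_quparity] at hC ⊢
    rcases hC with ⟨s, b, c, rfl⟩ | ⟨k, hk, s, b, c, rfl⟩ | ⟨s, rfl⟩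
    · left
      refine ⟨s, c, b, ?_⟩
      simp only [mapClause, pSigma1, Finset.image_union, Finset.image_insert, pAA,
        Finset.image_singleton]
      rw [Finset.insert_comm, Bool.xor_comm]
    · right; left
      refine ⟨k, hk, s, b, c, ?_⟩
      simp [mapClause, pSigma1, Finset.image_union, Finset.image_insert, pAA,
        Finset.image_singleton]
    · right; right
      exact ⟨s, by simp [mapClause, pSigma1, Finset.image_insert]⟩

/-! Derivation bookkeeping. -/

def ValidS (n : ℕ) (D : List (Clause PV)) : Prop :=
  ∀ i (hi : i < D.length), StepOKS (pPrefix n) (quparity n) D i (D[i]'hi)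

theorem avail_append {φ : Cnf PV} {D : List (Clause PV)} {E C : Clause PV} {i : ℕ}
    (h : Avail φ D i C) : Avail φ (D ++ [E]) i C := by
  rcases h with h | ⟨j, hj, hj', h⟩
  · exact Or.inl h
  · exact Or.inr ⟨j, hj, by simp; omega, by rw [List.getElem_append_left hj']; exact h⟩

theorem avail_last {φ : Cnf PV} {D : List (Clause PV)} {C : Clause PV}
    (h : C ∈ φ ∨ C ∈ D) : Avail φ D D.length C := by
  rcases h with h | h
  · exact Or.inl h
  · obtain ⟨j, hj, h⟩ := List.getElem_of_mem h
    exact Or.inr ⟨j, hj, hj, h⟩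

theorem stepOKS_append {P : QPrefix PV} {φ : Cnf PV} {D : List (Clause PV)} {E C : Clause PV}
    {i : ℕ} (h : StepOKS P φ D i C) : StepOKS P φ (D ++ [E]) i C := by
  rcases h with (⟨E₁, E₂, h1, h2, h3⟩ | ⟨F, h1, h2⟩) | ⟨F, σ, h1, h2⟩
  · exact Or.inl (Or.inl ⟨E₁, E₂, avail_append h1, avail_append h2, h3⟩)
  · exact Or.inl (Or.inr ⟨F, avail_append h1, h2⟩)
  · exact Or.inr ⟨F, σ, avail_append h1, h2⟩

theorem valid_append {n : ℕ} {D : List (Clause PV)} {E : Clause PV} (hD : ValidS n D)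
    (h : StepOKS (pPrefix n) (quparity n) D D.length E) : ValidS n (D ++ [E]) := by
  intro i hi
  by_cases hi' : i < D.length
  · rw [List.getElem_append_left hi']
    exact stepOKS_append (hD i hi')
  · have : i = D.length := by simp at hi; omega
    subst this
    simpa using stepOKS_append h

theorem valid_res {n : ℕ} {D : List (Clause PV)} {E₁ E₂ E : Clause PV} (hD : ValidS n D)
    (h1 : E₁ ∈ quparity n ∨ E₁ ∈ D) (h2 : E₂ ∈ quparity n ∨ E₂ ∈ D)
    (h : ResStep (pPrefix n) E₁ E₂ E) : ValidS n (D ++ [E]) :=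
  valid_append hD (Or.inl (Or.inl ⟨E₁, E₂, avail_last h1, avail_last h2, h⟩))

theorem valid_ured {n : ℕ} {D : List (Clause PV)} {E₁ E : Clause PV} (hD : ValidS n D)
    (h1 : E₁ ∈ quparity n ∨ E₁ ∈ D)
    (h : URed (pPrefix n) E₁ E) : ValidS n (D ++ [E]) :=
  valid_append hD (Or.inl (Or.inr ⟨E₁, avail_last h1, h⟩))

theorem valid_sym {n : ℕ} {D : List (Clause PV)} {E₁ E : Clause PV} {σ : Lit PV → Lit PV}
    (hD : ValidS n D) (h1 : E₁ ∈ quparity n ∨ E₁ ∈ D)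
    (h : IsSymmetry (pPrefix n) (quparity n) σ) (hE : E = mapClause σ E₁) :
    ValidS n (D ++ [E]) :=
  valid_append hD (Or.inr ⟨E₁, σ, avail_last h1, h, hE⟩)

/-- `C` is available after at most `k` counted steps. -/
def Reach (n k : ℕ) (C : Clause PV) : Prop :=
  ∃ D, ValidS n D ∧ D.length ≤ k ∧ (C ∈ quparity n ∨ C ∈ D)

/-- The clause `x_i ∨ … ∨ x_j`. -/
def xs (i j : ℕ) : Clause PV := (Finset.Icc i j).image (fun k => (PV.x k, true))

theorem mem_xs_x (i j k : ℕ) (b : Bool) : (PV.x k, b) ∈ xs i j ↔ (b = true ∧ i ≤ k ∧ k ≤ j) := by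
  simp only [xs, Finset.mem_image, Finset.mem_Icc, Prod.mk.injEq, PV.x.injEq]
  constructor
  · rintro ⟨a, h, rfl, rfl⟩; exact ⟨rfl, h⟩
  · rintro ⟨rfl, h⟩; exact ⟨k, h, rfl, rfl⟩

theorem mem_xs_y (i j k : ℕ) (b : Bool) : (PV.y k, b) ∉ xs i j := by
  simp [xs]

theorem mem_xs_a (i j k : ℕ) (b : Bool) : (PV.a k, b) ∉ xs i j := by
  simp [xs]

theorem reach_chain (n : ℕ) (d : ℕ) : ∀ j, 2 ≤ j → j + d = n →
    Reach n d (insert (PV.y j, true) (xs (j+1) n) ∪ pAA true) := by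
  induction d with
  | zero =>
    intro j hj hjn
    refine ⟨[], by simp [ValidS], by simp, Or.inl ?_⟩
    rw [mem_quparity]
    right; right
    refine ⟨true, ?_⟩
    obtain rfl : j = n := by omega
    ext ⟨v | v | v, b⟩ <;> simp [mem_xs_x, mem_xs_y, mem_xs_a, pAA] <;> grind
  | succ d ih =>
    intro j hj hjn
    obtain ⟨D, hD, hl, hm⟩ := ih (j+1) (by omega) (by omega)
    refine ⟨D ++ [_], valid_res hD hm (E₂ := ({(PV.y j, true), (PV.x (j+1), true),
      (PV.y (j+1), false)} : Clause PV) ∪ pAA true) (Or.inl ?_) ?_, by simp; omega, 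
      Or.inr (List.mem_append_right _ (List.mem_singleton.2 rfl))⟩
    · rw [mem_quparity]
      right; left
      refine ⟨j - 2, by omega, true, true, true, ?_⟩
      rw [show j - 2 + 2 = j by omega, show j - 2 + 3 = j + 1 by omega]
      rfl
    · refine ⟨PV.y (j+1), mem_pPrefix_y _ _ (by omega) (by omega), by simp, by simp, ?_, ?_⟩
      · ext ⟨v | v | v, b⟩ <;> simp [mem_xs_x, mem_xs_y, mem_xs_a, pAA] <;> grind
      · rintro ⟨⟨v | v | v, b⟩, h1, h2⟩ <;>
          simp [mem_xs_x, mem_xs_y, mem_xs_a, pAA, negLit] at h1 h2 <;> grind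

theorem reach_x_aa (n : ℕ) (hn : 2 ≤ n) : Reach n (n - 1) (xs 1 n ∪ pAA true) := by
  obtain ⟨D, hD, hl, hm⟩ := reach_chain n (n - 2) 2 le_rfl (by omega)
  refine ⟨D ++ [_], valid_res hD hm (E₂ := ({(PV.x 1, true), (PV.x 2, true),
      (PV.y 2, false)} : Clause PV) ∪ pAA true) (Or.inl ?_) ?_, by simp; omega, 
      Or.inr (List.mem_append_right _ (List.mem_singleton.2 rfl))⟩
  · rw [mem_quparity]
    left
    exact ⟨true, true, true, rfl⟩
  · refine ⟨PV.y 2, mem_pPrefix_y _ _ (by omega) (by omega), by simp, by simp, ?_, ?_⟩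
    · ext ⟨v | v | v, b⟩ <;> simp [mem_xs_x, mem_xs_y, mem_xs_a, pAA] <;> grind
    · rintro ⟨⟨v | v | v, b⟩, h1, h2⟩ <;>
        simp [mem_xs_x, mem_xs_y, mem_xs_a, pAA, negLit] at h1 h2 <;> grind

theorem ltP_x_a (n v : ℕ) (h1 : 1 ≤ v) (h2 : v ≤ n) (k : ℕ) (hk : k = 1 ∨ k = 2) :
    LtP (pPrefix n) (PV.x v) (PV.a k) := by
  have hx := pPrefix_get_x n (v-1) (by omega)
  rw [show v - 1 + 1 = v by omega] at hx
  rcases hk with rfl | rfl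
  · exact ⟨v - 1, n, by omega, ⟨_, hx⟩, ⟨_, pPrefix_get_a1 n⟩⟩
  · exact ⟨v - 1, n + 1, by omega, ⟨_, hx⟩, ⟨_, pPrefix_get_a2 n⟩⟩

theorem not_exist_a (n k : ℕ) : ¬ IsExist (pPrefix n) (PV.a k) := by
  simp [IsExist, pPrefix]

theorem reach_x (n : ℕ) (hn : 2 ≤ n) : Reach n (n + 1) (xs 1 n) := by
  obtain ⟨D, hD, hl, hm⟩ := reach_x_aa n hn
  have h1 : ValidS n (D ++ [insert (PV.a 1, true) (xs 1 n)]) := by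
    refine valid_ured hD hm ⟨(PV.a 2, true), by simp [IsUniv, pPrefix], by simp [pAA], ?_, ?_, ?_⟩
    · simp [negLit, mem_xs_a, pAA]
    · ext ⟨v | v | v, b⟩ <;> simp [mem_xs_x, mem_xs_y, mem_xs_a, pAA] <;> grind
    · rintro ⟨v | v | v, b⟩ h he
      · simp [mem_xs_x, pAA] at h
        exact ltP_x_a n v h.2.1 h.2.2 2 (by simp)
      · exact absurd he (not_exist_a _ _)
      · simp [mem_xs_y, pAA] at h
  refine ⟨_ ++ [_], valid_ured h1 (Or.inr (List.mem_append_right _ (List.mem_singleton.2 rfl)))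
    ⟨(PV.a 1, true), by simp [IsUniv, pPrefix], by simp, ?_, ?_, ?_⟩, by simp; omega,
    Or.inr (List.mem_append_right _ (List.mem_singleton.2 rfl))⟩
  · simp [negLit, mem_xs_a]
  · simp [mem_xs_a]
  · rintro ⟨v | v | v, b⟩ h he
    · simp [mem_xs_x] at h
      exact ltP_x_a n v h.2.1 h.2.2 1 (by simp)
    · exact absurd he (not_exist_a _ _)
    · simp [mem_xs_y] at h

theorem map_xs (n m : ℕ) (h1 : 1 ≤ m) :
    mapClause (pSigma n m) (xs 1 m) = insert (PV.x m, false) (xs 1 (m-1)) := by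
  ext l
  simp only [mapClause, xs, Finset.mem_image, Finset.mem_Icc, Finset.mem_insert]
  constructor
  · rintro ⟨_, ⟨k, hk, rfl⟩, rfl⟩
    by_cases h : k = m
    · left; simp [pSigma, h]
    · right; exact ⟨k, by omega, by simp [pSigma, h]⟩
  · rintro (rfl | ⟨k, hk, rfl⟩)
    · exact ⟨_, ⟨m, by omega, rfl⟩, by simp [pSigma]⟩
    · exact ⟨_, ⟨k, by omega, rfl⟩, by simp [pSigma, show k ≠ m by omega]⟩

theorem reach_down (n : ℕ) (hn : 2 ≤ n) (d : ℕ) : ∀ m, 1 ≤ m → m + d = n →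
    Reach n (n + 1 + 2 * d) (xs 1 m) := by
  induction d with
  | zero =>
    intro m h1 h2
    obtain rfl : m = n := by omega
    exact reach_x m hn
  | succ d ih =>
    intro m h1 h2
    obtain ⟨D, hD, hl, hm⟩ := ih (m+1) (by omega) (by omega)
    have hs := valid_sym hD hm (pSigma_symm n (m+1) (by omega) (by omega)) rfl
    rw [map_xs n (m+1) (by omega), Nat.add_sub_cancel] at hs
    refine ⟨_ ++ [_], valid_res hs (E₁ := xs 1 (m+1)) (hm.imp_right (List.mem_append_left _))
      (Or.inr (List.mem_append_right _ (List.mem_singleton.2 rfl))) ?_, by simp; omega,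
      Or.inr (List.mem_append_right _ (List.mem_singleton.2 rfl))⟩
    refine ⟨PV.x (m+1), mem_pPrefix_x _ _ (by omega) (by omega), ?_, by simp, ?_, ?_⟩
    · simp [mem_xs_x]
    · ext ⟨v | v | v, b⟩ <;> simp [mem_xs_x, mem_xs_y, mem_xs_a] <;> grind
    · rintro ⟨⟨v | v | v, b⟩, h1, h2⟩ <;>
        simp [mem_xs_x, mem_xs_y, mem_xs_a, negLit] at h1 h2 <;> grind

/-- QUPARITY_n has a Q-Res+S refutation with at most 3n+2
applications of the rules S, R, U. -/
theorem quparity_qres_s_short_refutation : ∀ n : ℕ, 2 ≤ n →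
    ∃ D : List (Clause PV),
      IsRefutationS (pPrefix n) (quparity n) D ∧ D.length ≤ 3 * n + 2 := by
  intro n hn
  obtain ⟨D, hD, hl, hm⟩ := reach_down n hn (n - 1) 1 le_rfl (by omega)
  have h1 : ValidS n (D ++ [{(PV.x 2, true)}]) :=
    valid_sym hD hm (pSigma1_symm n hn) (by simp [mapClause, xs, pSigma1])
  have h2 : ValidS n (D ++ [{(PV.x 2, true)}] ++ [{(PV.x 2, false)}]) :=
    valid_sym (E₁ := {(PV.x 2, true)}) h1 (Or.inr (by simp))
      (pSigma_symm n 2 le_rfl hn) (by simp [mapClause, pSigma])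
  have h3 : ValidS n (D ++ [{(PV.x 2, true)}] ++ [{(PV.x 2, false)}] ++ [∅]) :=
    valid_res (E₁ := {(PV.x 2, true)}) (E₂ := {(PV.x 2, false)}) h2
      (Or.inr (by simp)) (Or.inr (by simp))
      ⟨PV.x 2, mem_pPrefix_x _ _ (by omega) hn, by simp, by simp, by simp, by simp [Tauto]⟩
  exact ⟨_, ⟨h3, by simp⟩, by simp; omega⟩
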